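/- (Comparison with small-slope supersolutions) Let d = 2 or d = 3 and let B > 0. There exists a constant c(B) > 0 such that: if f : [0,T]×ℝ^{d−1} → ℝ is a classical subsolution of the d-dimensional Muskat equation with ‖∇_x f‖_{L∞} ≤ B, and g : [0,T]×ℝ^{d−1} → ℝ is a classical supersolution with ‖∇_x g‖_{L∞} < c(B), and f(0,x) ≤ g(0,x) for all x, then f(t,x) ≤ g(t,x) for all (t,x) ∈ [0,T]×ℝ^{d−1}. Moreover, for B sufficiently large one may take c(B) = B/(2(B² + 1)^{d/2}). -/

import Mathlib

open MeasureTheory Filter Set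
open scoped RealInnerProductSpace Topology

noncomputable section

/-- The horizontal slice `ℝ²` (the interface variable space for the 3D Muskat problem). -/
abbrev E2 := EuclideanSpace ℝ (Fin 2)

/-- The integrand of the `d`-dimensional Muskat equation:
`(δ_h g(x) − ∇g(x)·h) / (δ_h g(x)² + |h|²)^{d/2}`. -/
def muskatIntegrand (d : ℕ) {n : ℕ} (g : EuclideanSpace ℝ (Fin n) → ℝ)
    (x h : EuclideanSpace ℝ (Fin n)) : ℝ :=
  (g (x + h) - g x - ⟪gradient g x, h⟫) /
    ((g (x + h) - g x) ^ 2 + ‖h‖ ^ 2) ^ ((d : ℝ) / 2)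

/-- Principal value (over symmetric annuli `1/R < ‖h‖ < R` as `R → ∞`) of the integral of `F`. -/
def HasPV {n : ℕ} (F : EuclideanSpace ℝ (Fin n) → ℝ) (I : ℝ) : Prop :=
  Tendsto (fun R : ℝ => ∫ h in {h : EuclideanSpace ℝ (Fin n) | R⁻¹ < ‖h‖ ∧ ‖h‖ < R}, F h)
    atTop (𝓝 I)

/-- Definition 7.1 of the paper: a classical solution (`rel := Eq`), subsolution
(`rel := (· ≤ ·)`) or supersolution (`rel := fun a b => b ≤ a`) of the `d`-dimensional
Muskat equation on `[0,T]`. -/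
structure IsClassicalMuskat (d : ℕ) (T : ℝ) (rel : ℝ → ℝ → Prop)
    (f : ℝ → EuclideanSpace ℝ (Fin (d - 1)) → ℝ) : Prop where
  /-- `f` is `C¹` on `(0,T) × ℝ^{d-1}`. -/
  smooth : ContDiffOn ℝ 1 (fun p : ℝ × EuclideanSpace ℝ (Fin (d - 1)) => f p.1 p.2)
    (Ioo 0 T ×ˢ univ)
  /-- uniform-in-`x` limit at the initial time -/
  limit_zero : TendstoUniformly (fun t x => f t x) (f 0) (𝓝[>] (0 : ℝ))
  /-- uniform-in-`x` limit at the final time -/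
  limit_T : TendstoUniformly (fun t x => f t x) (f T) (𝓝[<] T)
  /-- local uniform differentiability and integrable sublinear growth bounds -/
  local_bounds : ∀ K : Set (ℝ × EuclideanSpace ℝ (Fin (d - 1))), IsCompact K →
    K ⊆ Ioo 0 T ×ˢ univ →
    ∃ ω Ω : ℝ → ℝ, (∀ r, 0 ≤ ω r) ∧ (∀ R, 0 ≤ Ω R) ∧
      (∀ p ∈ K, ∀ r > (0 : ℝ), ∀ h, ‖h‖ ≤ r →
        |f p.1 (p.2 + h) - f p.1 p.2 - ⟪gradient (f p.1) p.2, h⟫| ≤ ω r * r) ∧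
      (∀ p ∈ K, ∀ R > (0 : ℝ), ∀ h, ‖h‖ ≤ R → |f p.1 (p.2 + h) - f p.1 p.2| ≤ Ω R) ∧
      IntegrableOn (fun r => ω r / r) (Ioc 0 1) ∧
      IntegrableOn (fun R => Ω R / R ^ 2) (Ioi 1)
  /-- the Muskat equation (as a principal value), with `rel` relating `∂ₜ f` to the integral -/
  eqn : ∀ t ∈ Ioo 0 T, ∀ x, ∃ I : ℝ,
    HasPV (muskatIntegrand d (f t) x) I ∧ rel (deriv (fun s => f s x) t) I

/-- The comparison property of Proposition 7.6: every classical subsolution `f` with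
`‖∇f‖_{L∞} ≤ B` lies below every classical supersolution `g` with `‖∇g‖_{L∞} < cB`
once `f(0,·) ≤ g(0,·)`. -/
def MuskatCompProp (d : ℕ) (B cB : ℝ) : Prop :=
  ∀ T : ℝ, 0 < T → ∀ f g : ℝ → EuclideanSpace ℝ (Fin (d - 1)) → ℝ,
    IsClassicalMuskat d T (· ≤ ·) f →
    IsClassicalMuskat d T (fun a b => b ≤ a) g →
    (∀ t ∈ Icc 0 T, ∀ x, ‖gradient (f t) x‖ ≤ B) →
    (∃ M : ℝ, M < cB ∧ ∀ t ∈ Icc 0 T, ∀ x, ‖gradient (g t) x‖ ≤ M) →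
    (∀ x, f 0 x ≤ g 0 x) →
    ∀ t ∈ Icc 0 T, ∀ x, f t x ≤ g t x


def phi (d : ℕ) (q s : ℝ) : ℝ := (s - q) * (1 + s ^ 2) ^ (-((d : ℝ) / 2))

lemma base_pos (s : ℝ) : 0 < 1 + s ^ 2 := by positivity

lemma hasDerivAt_ker (d : ℕ) (s : ℝ) :
    HasDerivAt (fun s : ℝ => (1 + s ^ 2) ^ (-((d : ℝ) / 2)))
      (-(d : ℝ) * s * (1 + s ^ 2) ^ (-((d : ℝ) / 2) - 1)) s := by
  have h1 : HasDerivAt (fun s : ℝ => 1 + s ^ 2) (2 * s) s := by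
    simpa using ((hasDerivAt_pow 2 s).const_add 1)
  have h2 := h1.rpow_const (p := -((d : ℝ) / 2)) (Or.inl (base_pos s).ne')
  convert h2 using 1
  ring

lemma hasDerivAt_phi (d : ℕ) (q s : ℝ) :
    HasDerivAt (phi d q)
      ((1 - ((d : ℝ) - 1) * s ^ 2 + d * q * s) * (1 + s ^ 2) ^ (-((d : ℝ) / 2) - 1)) s := by
  have h1 : HasDerivAt (fun s : ℝ => s - q) 1 s := (hasDerivAt_id s).sub_const q
  have h2 := h1.mul (hasDerivAt_ker d s)
  refine h2.congr_deriv ?_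
  have : (1 + s ^ 2) ^ (-((d : ℝ) / 2)) = (1 + s ^ 2) ^ (-((d : ℝ) / 2) - 1) * (1 + s ^ 2) := by
    rw [Real.rpow_sub_one (base_pos s).ne']
    field_simp
  rw [this]
  ring

lemma ker_le_one (d : ℕ) (s : ℝ) : (1 + s ^ 2) ^ (-((d : ℝ) / 2)) ≤ 1 :=
  Real.rpow_le_one_of_one_le_of_nonpos (by nlinarith [sq_nonneg s]) (by
    have : (0 : ℝ) ≤ d := by positivity
    linarith)

lemma ker_pos (d : ℕ) (s : ℝ) : 0 < (1 + s ^ 2) ^ (-((d : ℝ) / 2)) :=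
  Real.rpow_pos_of_pos (base_pos s) _

lemma ker_lip (d : ℕ) (hd : d ≤ 3) (a b : ℝ) :
    |(1 + a ^ 2) ^ (-((d : ℝ) / 2)) - (1 + b ^ 2) ^ (-((d : ℝ) / 2))| ≤ 3 * |a - b| := by
  have hd' : (d : ℝ) ≤ 3 := by exact_mod_cast hd
  have := convex_univ.norm_image_sub_le_of_norm_hasDerivWithin_le
    (f := fun s : ℝ => (1 + s ^ 2) ^ (-((d : ℝ) / 2))) (C := 3) (x := b) (y := a)
    (fun x _ => (hasDerivAt_ker d x).hasDerivWithinAt) (fun x _ => ?_) (mem_univ _) (mem_univ _)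
  · simpa [Real.norm_eq_abs] using this
  · rw [Real.rpow_sub_one (base_pos x).ne', Real.norm_eq_abs, abs_mul, abs_mul, abs_neg, abs_div,
      abs_of_pos (ker_pos d x), abs_of_pos (base_pos x), abs_of_nonneg (by positivity : (0:ℝ) ≤ d)]
    have h1 := ker_le_one d x
    have h2 := ker_pos d x
    have h3 : |x| ≤ 1 + x ^ 2 := by
      nlinarith [sq_abs x, sq_nonneg (|x| - 1), abs_nonneg x]
    have h4 : (1 + x ^ 2) ^ (-((d : ℝ) / 2)) / (1 + x ^ 2) ≤ 1 / (1 + x ^ 2) := by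
      gcongr
    calc (d : ℝ) * |x| * ((1 + x ^ 2) ^ (-((d : ℝ) / 2)) / (1 + x ^ 2))
        ≤ 3 * (1 + x ^ 2) * (1 / (1 + x ^ 2)) := by gcongr
      _ = 3 := by field_simp

lemma phi_mono_small (d : ℕ) (hd : 2 ≤ d) (hd3 : d ≤ 3) {q s σ : ℝ} (hsσ : s ≤ σ)
    (hs : 0 ≤ 1 - ((d : ℝ) - 1) * s ^ 2 + d * q * s)
    (hσ : 0 ≤ 1 - ((d : ℝ) - 1) * σ ^ 2 + d * q * σ) : phi d q s ≤ phi d q σ := by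
  have hd' : (2 : ℝ) ≤ d := by exact_mod_cast hd
  have : MonotoneOn (phi d q) (Icc s σ) := by
    apply monotoneOn_of_deriv_nonneg (convex_Icc _ _)
    · exact fun x _ => (hasDerivAt_phi d q x).continuousAt.continuousWithinAt
    · exact fun x _ => (hasDerivAt_phi d q x).differentiableAt.differentiableWithinAt
    · intro x hx
      rw [interior_Icc] at hx
      rw [(hasDerivAt_phi d q x).deriv]
      apply mul_nonneg _ (Real.rpow_nonneg (base_pos x).le _)
      have h1 : 0 < σ - s := by linarith [hx.1, hx.2]
      have h2 : 0 ≤ (σ - s) * (1 - ((d : ℝ) - 1) * x ^ 2 + d * q * x) := by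
        have e : (σ - s) * (1 - ((d : ℝ) - 1) * x ^ 2 + d * q * x)
          = (σ - x) * (1 - ((d : ℝ) - 1) * s ^ 2 + d * q * s)
            + (x - s) * (1 - ((d : ℝ) - 1) * σ ^ 2 + d * q * σ)
            + ((d : ℝ) - 1) * ((σ - s) * ((σ - x) * (x - s))) := by ring
        rw [e]
        have a1 : 0 ≤ σ - x := by linarith [hx.2]
        have a2 : 0 ≤ x - s := by linarith [hx.1]
        have a3 : (0:ℝ) ≤ (d : ℝ) - 1 := by linarith
        positivity
      exact nonneg_of_mul_nonneg_right h2 h1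
  exact this (left_mem_Icc.2 hsσ) (right_mem_Icc.2 hsσ) hsσ

lemma N_nonneg (d : ℕ) (hd : 2 ≤ d) (hd3 : d ≤ 3) {q s : ℝ} (hq : |q| ≤ 1/4) (hs : |s| ≤ 1/4) :
    0 < 1 - ((d : ℝ) - 1) * s ^ 2 + d * q * s := by
  have hd' : (2 : ℝ) ≤ d := by exact_mod_cast hd
  have hd3' : (d : ℝ) ≤ 3 := by exact_mod_cast hd3
  have h1 : s ^ 2 ≤ 1/16 := by nlinarith [sq_abs s, abs_nonneg s]
  have h2 : |q * s| ≤ 1/16 := by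
    rw [abs_mul]; nlinarith [abs_nonneg s, abs_nonneg q]
  have h3 := (abs_le.1 h2).1
  nlinarith

lemma phi_anti (d : ℕ) (hd : 2 ≤ d) {q s b m : ℝ} (hbs : b ≤ s) (hsm : s ≤ m)
    (hs : 1 - ((d : ℝ) - 1) * s ^ 2 + d * q * s < 0)
    (hm : 0 ≤ 1 - ((d : ℝ) - 1) * m ^ 2 + d * q * m) : phi d q s ≤ phi d q b := by
  have hd' : (2 : ℝ) ≤ d := by exact_mod_cast hd
  have : AntitoneOn (phi d q) (Icc b s) := by
    apply antitoneOn_of_deriv_nonpos (convex_Icc _ _)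
    · exact fun x _ => (hasDerivAt_phi d q x).continuousAt.continuousWithinAt
    · exact fun x _ => (hasDerivAt_phi d q x).differentiableAt.differentiableWithinAt
    · intro x hx
      rw [interior_Icc] at hx
      rw [(hasDerivAt_phi d q x).deriv]
      apply mul_nonpos_of_nonpos_of_nonneg _ (Real.rpow_nonneg (base_pos x).le _)
      by_contra! hcon
      have e : (m - x) * (1 - ((d : ℝ) - 1) * s ^ 2 + d * q * s)
          = (m - s) * (1 - ((d : ℝ) - 1) * x ^ 2 + d * q * x)
            + (s - x) * (1 - ((d : ℝ) - 1) * m ^ 2 + d * q * m)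
            + ((d : ℝ) - 1) * ((m - x) * ((m - s) * (s - x))) := by ring
      have a1 : 0 ≤ m - s := by linarith
      have a2 : 0 < s - x := by linarith [hx.2]
      have a3 : (0:ℝ) ≤ (d : ℝ) - 1 := by linarith
      have a4 : 0 < m - x := by linarith
      have : 0 ≤ (m - x) * (1 - ((d : ℝ) - 1) * s ^ 2 + d * q * s) := by
        rw [e]; positivity
      nlinarith
  exact this (left_mem_Icc.2 hbs) (right_mem_Icc.2 hbs) hbs

/-- the threshold slope -/
def slopeC (d : ℕ) (B : ℝ) : ℝ := B / (2 * (B ^ 2 + 1) ^ ((d : ℝ) / 2))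

lemma slopeC_facts (d : ℕ) (hd : 2 ≤ d) {B : ℝ} (hB : 0 < B) : 0 < slopeC d B ∧ slopeC d B ≤ 1/4 ∧ slopeC d B ≤ B := by
  have hd' : (2 : ℝ) ≤ d := by exact_mod_cast hd
  have h1 : B ^ 2 + 1 ≤ (B ^ 2 + 1) ^ ((d : ℝ) / 2) := by
    have := Real.rpow_le_rpow_of_exponent_le (x := B ^ 2 + 1) (by nlinarith) (by linarith : (1:ℝ) ≤ (d:ℝ)/2)
    simpa using this
  have h0 : 0 < (B ^ 2 + 1) ^ ((d : ℝ) / 2) := by positivity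
  unfold slopeC
  refine ⟨by positivity, ?_, ?_⟩
  · rw [div_le_iff₀ (by positivity)]; nlinarith [sq_nonneg (B - 1)]
  · rw [div_le_iff₀ (by positivity)]; nlinarith [sq_nonneg B, mul_pos hB hB]

lemma phi_mono (d : ℕ) (hd : 2 ≤ d) (hd3 : d ≤ 3) {B M q s σ : ℝ} (hB : 0 < B) (hM : M ≤ slopeC d B)
    (hq : |q| ≤ M) (hσ : |σ| ≤ M) (hsB : -B ≤ s) (hsσ : s ≤ σ) : phi d q s ≤ phi d q σ := by
  obtain ⟨c0, c1, c2⟩ := slopeC_facts d hd hB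
  have hM0 : 0 ≤ M := (abs_nonneg q).trans hq
  have Nσ := N_nonneg d hd hd3 (hq.trans (by linarith)) (hσ.trans (by linarith))
  by_cases hN : 0 ≤ 1 - ((d : ℝ) - 1) * s ^ 2 + d * q * s
  · exact phi_mono_small d hd hd3 hsσ hN Nσ.le
  push Not at hN
  have NM := N_nonneg d hd hd3 (q := q) (s := -M) (hq.trans (by linarith))
    (by rw [abs_neg, abs_of_nonneg hM0]; linarith)
  have hsM : s ≤ -M := by
    by_contra! hc
    have := N_nonneg d hd hd3 (q := q) (s := s) (hq.trans (by linarith))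
      (by rw [abs_le]; constructor <;> linarith [(abs_le.1 hσ).2])
    linarith
  have e1 := phi_anti d hd hsB hsM hN NM.le
  have e2 := phi_mono_small d hd hd3 (abs_le.1 hσ).1 NM.le Nσ.le
  refine e1.trans (le_trans ?_ e2)
  have h2M : 2 * M ≤ B * (1 + B ^ 2) ^ (-((d : ℝ) / 2)) := by
    rw [Real.rpow_neg (base_pos B).le, add_comm 1 (B^2)]
    have : 2 * slopeC d B = B * ((B ^ 2 + 1) ^ ((d : ℝ) / 2))⁻¹ := by
      unfold slopeC; field_simp
    linarith
  unfold phi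
  have k1 := ker_le_one d M
  have k0 := ker_pos d M
  have k1' := ker_le_one d B
  have k0' := ker_pos d B
  rw [neg_sq, neg_sq]
  obtain ⟨q1, q2⟩ := abs_le.1 hq
  set kM := (1 + M ^ 2) ^ (-((d : ℝ) / 2))
  set kB := (1 + B ^ 2) ^ (-((d : ℝ) / 2))
  nlinarith

/-- near-field pointwise comparison -/
lemma near_bound (d : ℕ) (hd : 2 ≤ d) (hd3 : d ≤ 3) {B M τ q e sf sg κ l : ℝ} (hB : 0 < B)
    (hM0 : 0 ≤ M) (hτ : M + 2 * τ ≤ slopeC d B) (hq : |q| ≤ M) (he : |e| ≤ τ) (hκ0 : 0 ≤ κ) (hκ : κ ≤ τ)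
    (hl : 0 ≤ l)
    (hsf : -B ≤ sf) (hsg : |sg| ≤ M) (h1 : sf ≤ sg + e + κ) (h2 : sf ≤ q + e + l + κ)
    (h3 : q - l ≤ sg) :
    phi d (q + e) sf - phi d q sg ≤ 6 * τ * min l 1 + κ := by
  obtain ⟨c0, c1, c2⟩ := slopeC_facts d hd hB
  have hτ0 : 0 ≤ τ := hκ0.trans hκ
  obtain ⟨q1, q2⟩ := abs_le.1 hq
  obtain ⟨g1, g2⟩ := abs_le.1 hsg
  obtain ⟨e1, e2⟩ := abs_le.1 he
  set m := min sg (q + l) with hm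
  have m1 : m ≤ sg := min_le_left _ _
  have m2 : m ≤ q + l := min_le_right _ _
  have m3 : -M ≤ m := le_min g1 (by linarith)
  have m4 : q - l ≤ m := le_min h3 (by linarith)
  have hmM : |m| ≤ M := abs_le.2 ⟨m3, m1.trans g2⟩
  have hml : |m - q| ≤ min l 1 :=
    le_min (abs_le.2 ⟨by linarith, by linarith⟩) (abs_le.2 ⟨by linarith, by linarith⟩)
  set w := m + e + κ with hw
  have hsw : sf ≤ w := by
    rcases min_choice sg (q + l) with h | h <;> rw [hw, hm, h] <;> linarith
  have s1 : phi d (q + e) sf ≤ phi d (q + e) w :=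
    phi_mono d hd hd3 hB hτ (abs_le.2 ⟨by linarith, by linarith⟩)
      (abs_le.2 ⟨by linarith, by linarith⟩) hsf hsw
  have s2 : phi d q m ≤ phi d q sg :=
    phi_mono d hd hd3 hB (by linarith) hq hsg (by linarith) m1
  have s3 : phi d (q + e) w - phi d q m ≤ 6 * τ * min l 1 + κ := by
    have hk := ker_lip d hd3 w m
    have k1 := ker_le_one d w
    have k0 := ker_pos d w
    unfold phi
    set kw := (1 + w ^ 2) ^ (-((d : ℝ) / 2))
    set km := (1 + m ^ 2) ^ (-((d : ℝ) / 2))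
    have : (w - (q + e)) * kw - (m - q) * km = (m - q) * (kw - km) + κ * kw := by rw [hw]; ring
    rw [this]
    have b1 : |w - m| ≤ 2 * τ := abs_le.2 ⟨by linarith, by linarith⟩
    have b2 : (m - q) * (kw - km) ≤ min l 1 * (6 * τ) := by
      refine (le_abs_self _).trans ?_
      rw [abs_mul]
      apply mul_le_mul hml (by linarith) (abs_nonneg _) (le_min hl zero_le_one)
    nlinarith
  linarith

lemma far_bound (d : ℕ) (hd3 : d ≤ 3) {B q s : ℝ} (hq : |q| ≤ B) :
    |phi d q s + q| ≤ (1 + 3 * B) * |s| := by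
  have hk := ker_lip d hd3 s 0
  have k1 := ker_le_one d s
  have k0 := ker_pos d s
  simp only [ne_eq, OfNat.ofNat_ne_zero, not_false_eq_true, zero_pow, add_zero, Real.one_rpow,
    sub_zero] at hk
  unfold phi
  set kw := (1 + s ^ 2) ^ (-((d : ℝ) / 2))
  have : (s - q) * kw + q = s * kw + (-q) * (kw - 1) := by ring
  rw [this]
  refine (abs_add_le _ _).trans ?_
  rw [abs_mul, abs_mul, abs_neg, abs_of_pos k0]
  have := abs_nonneg s
  have := mul_le_mul hq hk (abs_nonneg _) ((abs_nonneg _).trans hq)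
  nlinarith

lemma muskatIntegrand_eq {n d : ℕ} (hd : d = n + 1) (hn : 1 ≤ n)
    (g : EuclideanSpace ℝ (Fin n) → ℝ) (x h : EuclideanSpace ℝ (Fin n)) (hh : h ≠ 0) :
    muskatIntegrand d g x h =
      (phi d (⟪gradient g x, h⟫ / ‖h‖) ((g (x + h) - g x) / ‖h‖) / ‖h‖) * (‖h‖ ^ (n - 1))⁻¹ := by
  have hr : 0 < ‖h‖ := norm_pos_iff.2 hh
  unfold muskatIntegrand phi
  set r := ‖h‖
  set a := g (x + h) - g x
  set b := ⟪gradient g x, h⟫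
  have e1 : a ^ 2 + r ^ 2 = r ^ 2 * (1 + (a / r) ^ 2) := by field_simp; ring
  have e2 : (r ^ 2) ^ ((d : ℝ) / 2) = r ^ d := by
    rw [← Real.rpow_natCast r 2, ← Real.rpow_mul hr.le, ← Real.rpow_natCast r d]
    congr 1
    push_cast; ring
  rw [e1, Real.mul_rpow (by positivity) (by positivity), e2, Real.rpow_neg (by positivity)]
  have e3 : r ^ d = r ^ (n - 1) * r * r := by
    rw [← pow_succ, ← pow_succ]; congr 1; omega
  rw [e3]
  have : 0 < (1 + (a / r) ^ 2) ^ ((d : ℝ) / 2) := by positivity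
  generalize (1 + (a / r) ^ 2) ^ ((d : ℝ) / 2) = K at *
  field_simp

lemma annulus_subset {n : ℕ} {R : ℝ} :
    {h : EuclideanSpace ℝ (Fin n) | R⁻¹ < ‖h‖ ∧ ‖h‖ < R} ⊆
      Metric.closedBall 0 R \ Metric.ball 0 R⁻¹ := by
  intro h hh
  simp only [Set.mem_sdiff, Metric.mem_closedBall, dist_zero_right, Metric.mem_ball, not_lt]
  exact ⟨hh.2.le, hh.1.le⟩

lemma annulus_measurable {n : ℕ} {R : ℝ} :
    MeasurableSet {h : EuclideanSpace ℝ (Fin n) | R⁻¹ < ‖h‖ ∧ ‖h‖ < R} := by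
  apply MeasurableSet.inter
  · exact measurableSet_lt measurable_const measurable_norm
  · exact measurableSet_lt measurable_norm measurable_const

lemma integrableOn_annulus {n : ℕ} {R : ℝ} (hR : 0 < R) {F : EuclideanSpace ℝ (Fin n) → ℝ}
    (hF : ContinuousOn F {0}ᶜ) :
    IntegrableOn F {h : EuclideanSpace ℝ (Fin n) | R⁻¹ < ‖h‖ ∧ ‖h‖ < R} := by
  have hc : IsCompact (Metric.closedBall (0 : EuclideanSpace ℝ (Fin n)) R \ Metric.ball 0 R⁻¹) :=
    (isCompact_closedBall _ _).diff Metric.isOpen_ball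
  refine IntegrableOn.mono_set (ContinuousOn.integrableOn_compact hc (hF.mono ?_)) annulus_subset
  intro h hh h0
  have : h = 0 := h0
  subst this
  exact hh.2 (Metric.mem_ball_self (by positivity))

lemma odd_integral_zero {n : ℕ} {R : ℝ} {o : EuclideanSpace ℝ (Fin n) → ℝ}
    (ho : ∀ h, o (-h) = - o h) :
    ∫ h in {h : EuclideanSpace ℝ (Fin n) | R⁻¹ < ‖h‖ ∧ ‖h‖ < R}, o h = 0 := by
  rw [← integral_indicator annulus_measurable]
  have h1 := integral_neg_eq_self
    (indicator {h : EuclideanSpace ℝ (Fin n) | R⁻¹ < ‖h‖ ∧ ‖h‖ < R} o) volume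
  have h2 : (fun x => indicator {h : EuclideanSpace ℝ (Fin n) | R⁻¹ < ‖h‖ ∧ ‖h‖ < R} o (-x))
      = fun x => - indicator {h : EuclideanSpace ℝ (Fin n) | R⁻¹ < ‖h‖ ∧ ‖h‖ < R} o x := by
    funext x
    simp only [indicator, mem_ofPred_eq, norm_neg, ho]
    split_ifs <;> simp
  rw [h2, integral_neg] at h1
  linarith

/-- the dimensional constant -/
def ballC (n : ℕ) : ℝ := n * volume.real (Metric.ball (0 : EuclideanSpace ℝ (Fin n)) 1)

lemma ballC_nonneg (n : ℕ) : 0 ≤ ballC n := by unfold ballC; positivity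

lemma PV_bound {n d : ℕ} (hn : 1 ≤ n) {κ : ℝ → ℝ} (hκi : IntegrableOn κ (Ioi 0))
    (hκ0 : ∀ r > 0, 0 ≤ κ r) {F G : EuclideanSpace ℝ (Fin n) → ℝ}
    (hF : ContinuousOn F {0}ᶜ) (hG : ContinuousOn G {0}ᶜ) (v : EuclideanSpace ℝ (Fin n)) (R₀ : ℝ)
    (hFG : ∀ h, h ≠ 0 → F h - G h ≤ κ ‖h‖ * (‖h‖ ^ (n - 1))⁻¹
      + (if R₀ < ‖h‖ then ⟪v, h⟫ / ‖h‖ ^ d else 0))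
    {I J : ℝ} (hI : HasPV F I) (hJ : HasPV G J) :
    I - J ≤ ballC n * ∫ r in Ioi 0, κ r := by
  have : Nonempty (Fin n) := ⟨⟨0, hn⟩⟩
  have hfr : Module.finrank ℝ (EuclideanSpace ℝ (Fin n)) = n := by simp
  have hcongr : ∀ y ∈ Ioi (0:ℝ), y ^ (n - 1) • (κ y * (y ^ (n - 1))⁻¹) = κ y := by
    intro y hy
    have : (0:ℝ) < y := hy
    simp only [smul_eq_mul]
    field_simp
  have hki : Integrable (fun h : EuclideanSpace ℝ (Fin n) => κ ‖h‖ * (‖h‖ ^ (n - 1))⁻¹) := by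
    rw [integrable_fun_norm_addHaar volume (f := fun r => κ r * (r ^ (n - 1))⁻¹), hfr]
    exact hκi.congr_fun (fun y hy => (hcongr y hy).symm) measurableSet_Ioi
  have hkint : ∫ h : EuclideanSpace ℝ (Fin n), κ ‖h‖ * (‖h‖ ^ (n - 1))⁻¹
      = ballC n * ∫ r in Ioi 0, κ r := by
    rw [integral_fun_norm_addHaar volume (fun r => κ r * (r ^ (n - 1))⁻¹), hfr,
      setIntegral_congr_fun measurableSet_Ioi hcongr]
    simp only [nsmul_eq_mul, smul_eq_mul, ballC]
    ring
  have hk0 : ∀ᵐ h : EuclideanSpace ℝ (Fin n), 0 ≤ κ ‖h‖ * (‖h‖ ^ (n - 1))⁻¹ := by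
    have : ∀ᵐ h : EuclideanSpace ℝ (Fin n), h ≠ 0 := by
      simp [ae_iff]
    filter_upwards [this] with h hh
    have := norm_pos_iff.2 hh
    have := hκ0 _ this
    positivity
  refine le_of_tendsto (hI.sub hJ) ?_
  filter_upwards [eventually_gt_atTop 0] with R hR
  set S := {h : EuclideanSpace ℝ (Fin n) | R⁻¹ < ‖h‖ ∧ ‖h‖ < R}
  set o : EuclideanSpace ℝ (Fin n) → ℝ := fun h => if R₀ < ‖h‖ then ⟪v, h⟫ / ‖h‖ ^ d else 0 with ho
  have hoI : IntegrableOn o S := by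
    have : o = indicator {h | R₀ < ‖h‖} (fun h => ⟪v, h⟫ / ‖h‖ ^ d) := by
      funext h; simp [ho, indicator]
    rw [this]
    apply Integrable.indicator _ (measurableSet_lt measurable_const measurable_norm)
    apply integrableOn_annulus hR
    apply ContinuousOn.div
    · fun_prop
    · fun_prop
    · intro h hh
      have : ‖h‖ ≠ 0 := norm_ne_zero_iff.2 hh
      positivity
  have ho0 : ∫ h in S, o h = 0 := by
    apply odd_integral_zero
    intro h
    simp only [ho, norm_neg, inner_neg_right, neg_div]
    split_ifs <;> simp
  have hFi := integrableOn_annulus hR hF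
  have hGi := integrableOn_annulus hR hG
  rw [← integral_sub hFi hGi]
  calc ∫ h in S, (F h - G h) ≤ ∫ h in S, (κ ‖h‖ * (‖h‖ ^ (n - 1))⁻¹ + o h) := by
        apply setIntegral_mono_on (hFi.sub hGi) (hki.integrableOn.add hoI) annulus_measurable
        intro h hh
        apply hFG
        rintro rfl
        have := hh.1
        rw [norm_zero] at this
        have := inv_pos.2 hR
        linarith
    _ = ∫ h in S, κ ‖h‖ * (‖h‖ ^ (n - 1))⁻¹ := by
        rw [integral_add hki.integrableOn hoI, ho0, add_zero]
    _ ≤ ∫ h, κ ‖h‖ * (‖h‖ ^ (n - 1))⁻¹ := setIntegral_le_integral hki hk0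
    _ = _ := hkint

lemma muskat_continuousOn {n d : ℕ} {g : EuclideanSpace ℝ (Fin n) → ℝ} (hg : Continuous g)
    (x : EuclideanSpace ℝ (Fin n)) : ContinuousOn (muskatIntegrand d g x) {0}ᶜ := by
  unfold muskatIntegrand
  have hpos : ∀ h ∈ ({0}ᶜ : Set (EuclideanSpace ℝ (Fin n))),
      0 < (g (x + h) - g x) ^ 2 + ‖h‖ ^ 2 := by
    intro h hh
    have : 0 < ‖h‖ := norm_pos_iff.2 hh
    positivity
  apply ContinuousOn.div
  · fun_prop
  · apply ContinuousOn.rpow_const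
    · fun_prop
    · exact fun h hh => Or.inl (hpos h hh).ne'
  · exact fun h hh => (Real.rpow_pos_of_pos (hpos h hh) _).ne'

lemma frequently_small {W : ℝ → ℝ} (hWi : IntegrableOn (fun R => W R / R ^ 2) (Ioi 1))
    {τ : ℝ} (hτ : 0 < τ) : ∃ᶠ R in atTop, W R / R * Real.log R < τ := by
  intro hcon
  have hcon' : ∀ᶠ R in atTop, τ ≤ W R / R * Real.log R := by
    filter_upwards [hcon] with R hR using not_lt.1 hR
  refine not_integrableOn_of_tendsto_norm_atTop_of_deriv_isBigO_filter
    (f := fun x => Real.log (Real.log x)) (g := fun R => W R / R ^ 2) (k := Ioi 1) atTop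
    (Ioi_mem_atTop 1) ?_ ?_ ?_ hWi
  · filter_upwards [eventually_gt_atTop 1] with x hx
    have := Real.log_pos hx
    exact (Real.differentiableAt_log this.ne').comp x (Real.differentiableAt_log (by linarith))
  · exact tendsto_norm_atTop_atTop.comp (Real.tendsto_log_atTop.comp Real.tendsto_log_atTop)
  · refine Asymptotics.IsBigO.of_bound τ⁻¹ ?_
    filter_upwards [eventually_gt_atTop 1, hcon'] with x hx hxx
    have hl := Real.log_pos hx
    have hd : HasDerivAt (fun x => Real.log (Real.log x)) (x⁻¹ / Real.log x) x :=
      (Real.hasDerivAt_log (by linarith)).log hl.ne'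
    have hx0 : 0 < x := by linarith
    rw [hd.deriv, Real.norm_eq_abs, abs_of_pos (by positivity)]
    refine le_trans ?_ (mul_le_mul_of_nonneg_left (le_abs_self _) (by positivity))
    rw [inv_mul_eq_div, le_div_iff₀ hτ, inv_eq_one_div, div_div, div_mul_eq_mul_div,
      div_le_div_iff₀ (by positivity) (by positivity)]
    have : W x / x * Real.log x * x = W x * Real.log x := by field_simp
    have h2 : τ * x ≤ W x * Real.log x := by
      rw [← this]; gcongr
    nlinarith

lemma tail_tendsto {V : ℝ → ℝ} (hV : IntegrableOn V (Ioi 1)) :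
    Tendsto (fun R : ℝ => ∫ r in Ioi (R / 2), V r) atTop (𝓝 0) := by
  have := tendsto_setIntegral_of_antitone (μ := volume) (f := V) (s := fun R : ℝ => Ioi (R / 2))
    (fun _ => measurableSet_Ioi) (fun a b hab => Ioi_subset_Ioi (by linarith))
    ⟨2, by simpa using hV⟩
  have he : ⋂ R : ℝ, Ioi (R / 2) = ∅ := by
    ext x
    simp only [mem_iInter, mem_Ioi, mem_empty_iff_false, iff_false, not_forall, not_lt]
    exact ⟨2 * x, by linarith⟩
  simpa [he] using this

lemma exists_growth {n : ℕ} {f : ℝ → EuclideanSpace ℝ (Fin n) → ℝ} {a b : ℝ} (hab : a ≤ b)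
    {Ω : ℝ → ℝ} (hΩ : ∀ t ∈ Icc a b, ∀ R > 0, ∀ h, ‖h‖ ≤ R → |f t h - f t 0| ≤ Ω R)
    (hΩi : IntegrableOn (fun R => Ω R / R ^ 2) (Ioi 1)) :
    ∃ W : ℝ → ℝ, Monotone W ∧ (∀ R, 0 ≤ W R) ∧
      (∀ t ∈ Icc a b, ∀ R ≥ 0, ∀ h, ‖h‖ ≤ R → |f t h - f t 0| ≤ W R) ∧
      IntegrableOn (fun R => W R / R ^ 2) (Ioi 1) := by
  set A : ℝ → Set ℝ := fun R => {z | ∃ t ∈ Icc a b, ∃ h, ‖h‖ ≤ max R 0 ∧ z = |f t h - f t 0|} with hA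
  have hbd : ∀ R, Ω (max R 1) ∈ upperBounds (A R) := by
    rintro R z ⟨t, ht, h, hh, rfl⟩
    exact hΩ t ht _ (by positivity) h (hh.trans (max_le_max le_rfl zero_le_one))
  have hne : ∀ R, (A R).Nonempty := fun R =>
    ⟨_, a, left_mem_Icc.2 hab, 0, by simp, rfl⟩
  have hmono : Monotone (fun R => sSup (A R)) := by
    intro R R' hRR
    apply csSup_le_csSup ⟨_, hbd R'⟩ (hne R)
    rintro z ⟨t, ht, h, hh, rfl⟩
    exact ⟨t, ht, h, hh.trans (max_le_max hRR le_rfl), rfl⟩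
  have hnn : ∀ R, 0 ≤ sSup (A R) := by
    intro R
    apply Real.sSup_nonneg
    rintro z ⟨t, ht, h, hh, rfl⟩
    exact abs_nonneg _
  refine ⟨fun R => sSup (A R), hmono, hnn, ?_, ?_⟩
  · intro t ht R hR h hh
    exact le_csSup ⟨_, hbd R⟩ ⟨t, ht, h, hh.trans (le_max_left _ _), rfl⟩
  · refine Integrable.mono' hΩi ?_ ?_
    · exact ((hmono.measurable.div (measurable_id.pow_const 2)).aestronglyMeasurable)
    · rw [ae_restrict_iff' measurableSet_Ioi]
      refine Eventually.of_forall fun R hR => ?_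
      have hR1 : (1:ℝ) < R := hR
      have := hnn R
      rw [Real.norm_eq_abs, abs_of_nonneg (by positivity)]
      gcongr
      apply csSup_le (hne R)
      have := hbd R
      rwa [max_eq_left hR1.le] at this

lemma scaled_growth {W : ℝ → ℝ} (hWi : IntegrableOn (fun R => W R / R ^ 2) (Ioi 1)) :
    IntegrableOn (fun r => W (3 * r) / r ^ 2) (Ioi 1) := by
  have h1 : IntegrableOn (fun R => W R / R ^ 2) (Ioi (3 * 1)) :=
    hWi.mono_set (Ioi_subset_Ioi (by norm_num))
  have h2 := (integrableOn_Ioi_comp_mul_left_iff (fun R => W R / R ^ 2) 1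
    (by norm_num : (0:ℝ) < 3)).2 h1
  refine IntegrableOn.congr_fun (h2.const_mul 9) ?_ measurableSet_Ioi
  intro r hr
  have : (0:ℝ) < r := lt_trans one_pos hr
  simp only
  field_simp
  ring

/-- the dominating radial profile -/
def kap (δ ε R C : ℝ) (V : ℝ → ℝ) (r : ℝ) : ℝ :=
  (Ioc 0 1).indicator (fun _ => 3 * (ε * R) / δ) r + (Ioc 0 (R / 2)).indicator (fun _ => ε) r
    + (Ioc 1 (R / 2)).indicator (fun r => 6 * (ε * R) * r⁻¹) r
    + (Ioi (R / 2)).indicator (fun r => C * (V r / r ^ 2)) r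

lemma kap_nonneg {δ ε R C : ℝ} {V : ℝ → ℝ} (hδ : 0 < δ) (hε : 0 < ε) (hR : 2 ≤ R) (hC : 0 ≤ C)
    (hV : ∀ r, 0 ≤ V r) (r : ℝ) (hr : 0 < r) : 0 ≤ kap δ ε R C V r := by
  have hR0 : 0 < R := by linarith
  unfold kap
  refine add_nonneg (add_nonneg (add_nonneg ?_ ?_) ?_) ?_
  · exact indicator_apply_nonneg fun _ => by positivity
  · exact indicator_apply_nonneg fun _ => by positivity
  · exact indicator_apply_nonneg fun _ => by positivity
  · exact indicator_apply_nonneg fun _ => by have := hV r; positivity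

lemma kap_int {δ ε R C : ℝ} {V : ℝ → ℝ} (hR : 2 ≤ R)
    (hVi : IntegrableOn (fun r => V r / r ^ 2) (Ioi 1)) :
    IntegrableOn (kap δ ε R C V) (Ioi 0) ∧
    ∫ r in Ioi 0, kap δ ε R C V r = 3 * (ε * R) / δ + ε * R / 2 + 6 * (ε * R) * Real.log (R / 2)
      + C * ∫ r in Ioi (R / 2), V r / r ^ 2 := by
  have i1 : IntegrableOn ((Ioc 0 1).indicator (fun _ => 3 * (ε * R) / δ)) (Ioi (0:ℝ)) := by
    refine Integrable.integrableOn ((integrable_indicator_iff measurableSet_Ioc).2 ?_)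
    exact integrableOn_const (by simp)
  have i2 : IntegrableOn ((Ioc 0 (R / 2)).indicator (fun _ => ε)) (Ioi (0:ℝ)) := by
    refine Integrable.integrableOn ((integrable_indicator_iff measurableSet_Ioc).2 ?_)
    exact integrableOn_const (by simp)
  have i3 : IntegrableOn ((Ioc 1 (R / 2)).indicator (fun r => 6 * (ε * R) * r⁻¹)) (Ioi (0:ℝ)) := by
    refine Integrable.integrableOn ((integrable_indicator_iff measurableSet_Ioc).2 ?_)
    refine IntegrableOn.mono_set ?_ Ioc_subset_Icc_self
    apply ContinuousOn.integrableOn_Icc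
    apply ContinuousOn.mul continuousOn_const
    apply ContinuousOn.inv₀ continuousOn_id
    intro r hr
    have : (1:ℝ) ≤ r := hr.1
    simp only [id]
    linarith
  have i4 : IntegrableOn ((Ioi (R / 2)).indicator (fun r => C * (V r / r ^ 2))) (Ioi (0:ℝ)) := by
    refine Integrable.integrableOn ((integrable_indicator_iff measurableSet_Ioi).2 ?_)
    exact Integrable.const_mul (hVi.mono_set (Ioi_subset_Ioi (by linarith))) C
  refine ⟨((i1.add i2).add i3).add i4, ?_⟩
  unfold kap
  rw [integral_add, integral_add, integral_add i1 i2]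
  rotate_left
  · exact i1.add i2
  · exact i3
  · exact (i1.add i2).add i3
  · exact i4
  have j1 : Ioc (0:ℝ) 1 ⊆ Ioi 0 := fun z hz => hz.1
  have j2 : Ioc (0:ℝ) (R/2) ⊆ Ioi 0 := fun z hz => hz.1
  have j3 : Ioc (1:ℝ) (R/2) ⊆ Ioi 0 := fun z hz => lt_trans one_pos hz.1
  have j4 : Ioi (R/2) ⊆ Ioi (0:ℝ) := Ioi_subset_Ioi (by linarith)
  rw [setIntegral_indicator measurableSet_Ioc, setIntegral_indicator measurableSet_Ioc,
    setIntegral_indicator measurableSet_Ioc, setIntegral_indicator measurableSet_Ioi,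
    inter_eq_right.2 j1, inter_eq_right.2 j2, inter_eq_right.2 j3, inter_eq_right.2 j4]
  rw [← intervalIntegral.integral_of_le (by linarith : (1:ℝ) ≤ R/2),
    intervalIntegral.integral_const_mul, integral_inv_of_pos one_pos (by linarith),
    integral_const_mul]
  have : 0 ≤ R / 2 := by linarith
  simp [this]
  ring

lemma spatial {n d : ℕ} (hd : d = n + 1) (hn : 1 ≤ n) (hn2 : n ≤ 2)
    {u v : EuclideanSpace ℝ (Fin n) → ℝ} (hu : Continuous u) (hv : Continuous v)
    {B M δ ε R : ℝ} (hB : 0 < B) (hM0 : 0 ≤ M) (hδ : 0 < δ) (hε : 0 < ε) (hR : 2 ≤ R)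
    (hσ : M + 2 * (ε * R) ≤ slopeC d B)
    (hub : ∀ a b, |u a - u b| ≤ B * ‖a - b‖) (hvb : ∀ a b, |v a - v b| ≤ M * ‖a - b‖)
    {x y p : EuclideanSpace ℝ (Fin n)} (hx : ‖x‖ ≤ R / 2)
    (hgu : gradient u x = p + (2 * ε) • x) (hgv : gradient v y = p)
    (hp : ‖p‖ ≤ M) (hguB : ‖gradient u x‖ ≤ B)
    (h1 : ∀ h, ‖h‖ ≤ R / 2 →
      u (x + h) - u x ≤ v (y + h) - v y + ε * (2 * ⟪x, h⟫ + ‖h‖ ^ 2))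
    (h2 : ∀ h, ‖h‖ ≤ R / 2 →
      u (x + h) - u x ≤ ⟪p, h⟫ + ‖h‖ ^ 2 / (2 * δ) + ε * (2 * ⟪x, h⟫ + ‖h‖ ^ 2))
    (h3 : ∀ h, ‖h‖ ≤ R / 2 → ⟪p, h⟫ - ‖h‖ ^ 2 / (2 * δ) ≤ v (y + h) - v y)
    {V : ℝ → ℝ} (hV : ∀ r, 0 ≤ V r) (hVi : IntegrableOn (fun r => V r / r ^ 2) (Ioi 1))
    (h4 : ∀ h, R / 2 < ‖h‖ → |u (x + h) - u x| ≤ 2 * V ‖h‖)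
    (h5 : ∀ h, R / 2 < ‖h‖ → |v (y + h) - v y| ≤ 2 * V ‖h‖)
    {I J : ℝ} (hI : HasPV (muskatIntegrand d u x) I) (hJ : HasPV (muskatIntegrand d v y) J) :
    I - J ≤ ballC n * (3 * (ε * R) / δ + ε * R / 2 + 6 * (ε * R) * Real.log (R / 2)
      + (2 * (2 + 3 * B + 3 * M)) * ∫ r in Ioi (R / 2), V r / r ^ 2) := by
  have hd2 : 2 ≤ d := by omega
  have hd3 : d ≤ 3 := by omega
  obtain ⟨ki, ke⟩ := kap_int (δ := δ) (ε := ε) (C := 2 * (2 + 3 * B + 3 * M)) hR hVi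
  have hC : 0 ≤ 2 * (2 + 3 * B + 3 * M) := by positivity
  rw [← ke]
  refine PV_bound (d := d) hn ki (kap_nonneg hδ hε hR hC hV) (muskat_continuousOn hu x)
    (muskat_continuousOn hv y) (gradient v y - gradient u x) (R / 2) ?_ hI hJ
  intro h hh
  have hr : 0 < ‖h‖ := norm_pos_iff.2 hh
  have hR0 : 0 < R := by linarith
  rw [muskatIntegrand_eq hd hn u x h hh, muskatIntegrand_eq hd hn v y h hh]
  have hrn : ‖h‖ ^ d = ‖h‖ ^ (n - 1) * ‖h‖ * ‖h‖ := by
    rw [← pow_succ, ← pow_succ]; congr 1; omega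
  have hodd : (if R / 2 < ‖h‖ then ⟪gradient v y - gradient u x, h⟫ / ‖h‖ ^ d else 0)
      = (if R / 2 < ‖h‖ then (⟪gradient v y, h⟫ / ‖h‖ - ⟪gradient u x, h⟫ / ‖h‖) / ‖h‖ else 0)
        * (‖h‖ ^ (n - 1))⁻¹ := by
    split_ifs
    · rw [hrn, inner_sub_left]; field_simp
    · simp
  rw [hodd, ← sub_mul, ← add_mul]
  refine mul_le_mul_of_nonneg_right ?_ (by positivity)
  have hcs : ∀ z : EuclideanSpace ℝ (Fin n), |⟪z, h⟫ / ‖h‖| ≤ ‖z‖ := by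
    intro z
    rw [abs_div, abs_norm, div_le_iff₀ hr]
    exact abs_real_inner_le_norm z h
  have hqv : |⟪gradient v y, h⟫ / ‖h‖| ≤ M := (hcs _).trans (hgv ▸ hp)
  have hqu : |⟪gradient u x, h⟫ / ‖h‖| ≤ B := (hcs _).trans hguB
  have hsu : |(u (x + h) - u x) / ‖h‖| ≤ B := by
    rw [abs_div, abs_norm, div_le_iff₀ hr]
    simpa using hub (x + h) x
  have hsv : |(v (y + h) - v y) / ‖h‖| ≤ M := by
    rw [abs_div, abs_norm, div_le_iff₀ hr]
    simpa using hvb (y + h) y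
  by_cases hfar : R / 2 < ‖h‖
  · rw [if_pos hfar]
    have k : kap δ ε R (2 * (2 + 3 * B + 3 * M)) V ‖h‖
        = 2 * (2 + 3 * B + 3 * M) * (V ‖h‖ / ‖h‖ ^ 2) := by
      unfold kap
      rw [indicator_of_notMem, indicator_of_notMem, indicator_of_notMem, indicator_of_mem]
      · ring
      · exact hfar
      · exact fun hz => absurd hz.2 (not_le.2 hfar)
      · exact fun hz => absurd hz.2 (not_le.2 hfar)
      · exact fun hz => absurd hz.2 (not_le.2 (by linarith))
    rw [k]
    have b1 := (abs_le.1 (far_bound d hd3 (s := (u (x + h) - u x) / ‖h‖) hqu)).2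
    have b2 := (abs_le.1 (far_bound d hd3 (s := (v (y + h) - v y) / ‖h‖) hqv)).1
    have c1 : |(u (x + h) - u x) / ‖h‖| ≤ 2 * V ‖h‖ / ‖h‖ := by
      rw [abs_div, abs_norm]; gcongr; exact h4 h hfar
    have c2 : |(v (y + h) - v y) / ‖h‖| ≤ 2 * V ‖h‖ / ‖h‖ := by
      rw [abs_div, abs_norm]; gcongr; exact h5 h hfar
    have b1' := b1.trans (mul_le_mul_of_nonneg_left c1 (by positivity))
    have b2' := (mul_le_mul_of_nonneg_left c2 (by positivity : 0 ≤ 1 + 3 * M))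
    have e : 2 * (2 + 3 * B + 3 * M) * (V ‖h‖ / ‖h‖ ^ 2)
      = ((1 + 3 * B) * (2 * V ‖h‖ / ‖h‖) + (1 + 3 * M) * (2 * V ‖h‖ / ‖h‖)) / ‖h‖ := by
      field_simp; ring
    rw [e, ← sub_div, ← add_div]
    gcongr
    linarith
  · rw [if_neg hfar, add_zero]
    push Not at hfar
    have e1 : ⟪gradient u x, h⟫ / ‖h‖ = ⟪gradient v y, h⟫ / ‖h‖ + 2 * ε * ⟪x, h⟫ / ‖h‖ := by
      rw [hgu, hgv, inner_add_left, real_inner_smul_left, add_div]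
    have he : |2 * ε * ⟪x, h⟫ / ‖h‖| ≤ ε * R := by
      rw [mul_div_assoc, abs_mul, abs_of_pos (by positivity : 0 < 2 * ε)]
      have := (hcs x).trans hx
      nlinarith
    have nb := near_bound d hd2 hd3 (τ := ε * R) (κ := ε * ‖h‖) (l := ‖h‖ / (2 * δ)) hB hM0 hσ hqv he
      (by positivity) (by nlinarith) (by positivity) (abs_le.1 hsu).1 hsv
      (by
        have := h1 h hfar
        rw [div_le_iff₀ hr]
        have e : ((v (y + h) - v y) / ‖h‖ + 2 * ε * ⟪x, h⟫ / ‖h‖ + ε * ‖h‖) * ‖h‖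
          = v (y + h) - v y + ε * (2 * ⟪x, h⟫ + ‖h‖ ^ 2) := by field_simp; ring
        rw [e]; exact this)
      (by
        have := h2 h hfar
        rw [div_le_iff₀ hr, hgv]
        have e : (⟪p, h⟫ / ‖h‖ + 2 * ε * ⟪x, h⟫ / ‖h‖ + ‖h‖ / (2 * δ) + ε * ‖h‖) * ‖h‖
          = ⟪p, h⟫ + ‖h‖ ^ 2 / (2 * δ) + ε * (2 * ⟪x, h⟫ + ‖h‖ ^ 2) := by field_simp; ring
        rw [e]; exact this)
      (by
        have := h3 h hfar
        rw [le_div_iff₀ hr, hgv]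
        have e : (⟪p, h⟫ / ‖h‖ - ‖h‖ / (2 * δ)) * ‖h‖
          = ⟪p, h⟫ - ‖h‖ ^ 2 / (2 * δ) := by field_simp
        rw [e]; exact this)
    rw [← e1] at nb
    rw [← sub_div, div_le_iff₀ hr]
    refine nb.trans ?_
    unfold kap
    have m1 : ‖h‖ ∈ Ioc 0 (R / 2) := ⟨hr, hfar⟩
    have m2 : ‖h‖ ∉ Ioi (R / 2) := fun hz => absurd hz (not_lt.2 hfar)
    rw [indicator_of_mem m1, indicator_of_notMem m2]
    by_cases hr1 : ‖h‖ ≤ 1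
    · have m3 : ‖h‖ ∈ Ioc (0:ℝ) 1 := ⟨hr, hr1⟩
      have m4 : ‖h‖ ∉ Ioc 1 (R / 2) := fun hz => absurd hz.1 (not_lt.2 hr1)
      rw [indicator_of_mem m3, indicator_of_notMem m4]
      have : 6 * (ε * R) * min (‖h‖ / (2 * δ)) 1 ≤ 6 * (ε * R) * (‖h‖ / (2 * δ)) := by
        gcongr; exact min_le_left _ _
      have e : (3 * (ε * R) / δ + ε + 0 + 0) * ‖h‖ = 6 * (ε * R) * (‖h‖ / (2 * δ)) + ε * ‖h‖ := by
        field_simp; ring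
      rw [e]; linarith
    · have m3 : ‖h‖ ∉ Ioc (0:ℝ) 1 := fun hz => hr1 hz.2
      have m4 : ‖h‖ ∈ Ioc 1 (R / 2) := ⟨not_le.1 hr1, hfar⟩
      rw [indicator_of_notMem m3, indicator_of_mem m4]
      have : 6 * (ε * R) * min (‖h‖ / (2 * δ)) 1 ≤ 6 * (ε * R) * 1 := by
        gcongr; exact min_le_right _ _
      have e : (0 + ε + 6 * (ε * R) * ‖h‖⁻¹ + 0) * ‖h‖ = 6 * (ε * R) * 1 + ε * ‖h‖ := by
        field_simp; ring
      rw [e]; linarith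

lemma grad_of_touch {n : ℕ} {u : EuclideanSpace ℝ (Fin n) → ℝ} {x P : EuclideanSpace ℝ (Fin n)}
    (hu : DifferentiableAt ℝ u x) {r C : ℝ} (hr : 0 < r)
    (h : ∀ h, ‖h‖ ≤ r → u (x + h) - u x ≤ ⟪P, h⟫ + C * ‖h‖ ^ 2) : gradient u x = P := by
  have hmax : IsLocalMax (fun h => u (x + h) - innerSL ℝ P h - C * ‖h‖ ^ 2) 0 := by
    filter_upwards [Metric.closedBall_mem_nhds (0 : EuclideanSpace ℝ (Fin n)) hr] with z hz
    have hz' : ‖z‖ ≤ r := by simpa using hz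
    have := h z hz'
    simp only [add_zero, map_zero, norm_zero, innerSL_apply_apply]
    nlinarith
  have h1 : HasFDerivAt (fun h => u (x + h)) (fderiv ℝ u x) 0 := by
    have e : HasFDerivAt u (fderiv ℝ u x) (x + 0) := by simpa using hu.hasFDerivAt
    exact (hasFDerivAt_comp_add_left x).2 e
  have h2 : HasFDerivAt (fun h : EuclideanSpace ℝ (Fin n) => innerSL ℝ P h) (innerSL ℝ P) 0 :=
    (innerSL ℝ P).hasFDerivAt
  have h3 : HasFDerivAt (fun h : EuclideanSpace ℝ (Fin n) => C * ‖h‖ ^ 2)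
      (0 : EuclideanSpace ℝ (Fin n) →L[ℝ] ℝ) 0 := by
    have := (hasStrictFDerivAt_norm_sq (0 : EuclideanSpace ℝ (Fin n))).hasFDerivAt.const_mul C
    simpa using this
  have h0 := hmax.hasFDerivAt_eq_zero ((h1.sub h2).sub h3)
  have h4 : fderiv ℝ u x = innerSL ℝ P := by
    rw [sub_zero] at h0
    exact sub_eq_zero.1 h0
  unfold gradient
  rw [h4]
  apply (InnerProductSpace.toDual ℝ _).injective
  rw [LinearIsometryEquiv.apply_symm_apply]
  rfl

lemma lip_of_grad {n : ℕ} {u : EuclideanSpace ℝ (Fin n) → ℝ} (hu : Differentiable ℝ u) {B : ℝ}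
    (hB : ∀ x, ‖gradient u x‖ ≤ B) (a b : EuclideanSpace ℝ (Fin n)) :
    |u a - u b| ≤ B * ‖a - b‖ := by
  have := convex_univ.norm_image_sub_le_of_norm_fderiv_le (𝕜 := ℝ) (f := u) (C := B) (x := b) (y := a)
    (fun x _ => hu x) (fun x _ => ?_) (mem_univ _) (mem_univ _)
  · simpa [Real.norm_eq_abs] using this
  · have h := hB x
    unfold gradient at h
    rwa [LinearIsometryEquiv.norm_map] at h

lemma deriv_nonneg_of_left_max {φ : ℝ → ℝ} {φ' a t : ℝ} (hφ : HasDerivAt φ φ' t) (hat : a < t)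
    (h : ∀ s ∈ Icc a t, φ s ≤ φ t) : 0 ≤ φ' := by
  have h1 := (hasDerivWithinAt_iff_tendsto_slope' (s := Iio t) (by simp)).1 (hφ.hasDerivWithinAt)
  refine ge_of_tendsto h1 ?_
  filter_upwards [Ioo_mem_nhdsLT hat] with s hs
  rw [slope_def_field]
  apply div_nonneg_of_nonpos
  · linarith [h s ⟨hs.1.le, hs.2.le⟩]
  · linarith [hs.2]

lemma const_growth (C : ℝ) : IntegrableOn (fun R : ℝ => C / R ^ 2) (Ioi 1) := by
  have := (integrableOn_Ioi_rpow_of_lt (a := -2) (by norm_num) (zero_lt_one)).const_mul C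
  refine IntegrableOn.congr_fun this ?_ measurableSet_Ioi
  intro r hr
  have hr0 : (0:ℝ) < r := lt_trans one_pos hr
  simp only
  rw [Real.rpow_neg hr0.le, div_eq_mul_inv]
  norm_num

set_option maxHeartbeats 4000000 in
lemma core {n d : ℕ} (hd : d = n + 1) (hn : 1 ≤ n) (hn2 : n ≤ 2) {B M : ℝ} (hB : 0 < B)
    (hM0 : 0 ≤ M) (hM : M < slopeC d B) {f g : ℝ → EuclideanSpace ℝ (Fin n) → ℝ} {a b κ : ℝ} (hab : a < b)
    (hκ : 0 ≤ κ)
    (hfd : ∀ t ∈ Icc a b, ∀ x, DifferentiableAt ℝ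
      (fun p : ℝ × EuclideanSpace ℝ (Fin n) => f p.1 p.2) (t, x))
    (hgd : ∀ t ∈ Icc a b, ∀ x, DifferentiableAt ℝ
      (fun p : ℝ × EuclideanSpace ℝ (Fin n) => g p.1 p.2) (t, x))
    (hfW : ∃ W : ℝ → ℝ, Monotone W ∧ (∀ R, 0 ≤ W R) ∧
      (∀ t ∈ Icc a b, ∀ R ≥ 0, ∀ h, ‖h‖ ≤ R → |f t h - f t 0| ≤ W R) ∧
      IntegrableOn (fun R => W R / R ^ 2) (Ioi 1))
    (hgW : ∃ W : ℝ → ℝ, Monotone W ∧ (∀ R, 0 ≤ W R) ∧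
      (∀ t ∈ Icc a b, ∀ R ≥ 0, ∀ h, ‖h‖ ≤ R → |g t h - g t 0| ≤ W R) ∧
      IntegrableOn (fun R => W R / R ^ 2) (Ioi 1))
    (hfe : ∀ t ∈ Icc a b, ∀ x, ∃ I : ℝ,
      HasPV (muskatIntegrand d (f t) x) I ∧ deriv (fun s => f s x) t ≤ I)
    (hge : ∀ t ∈ Icc a b, ∀ x, ∃ I : ℝ,
      HasPV (muskatIntegrand d (g t) x) I ∧ I ≤ deriv (fun s => g s x) t)
    (hfB : ∀ t ∈ Icc a b, ∀ x, ‖gradient (f t) x‖ ≤ B)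
    (hgM : ∀ t ∈ Icc a b, ∀ x, ‖gradient (g t) x‖ ≤ M)
    (hinit : ∀ x, f a x ≤ g a x + κ) :
    ∀ t ∈ Icc a b, ∀ x, f t x ≤ g t x + κ := by
  by_contra! hcon
  obtain ⟨t₁, ht₁, x₁, hx₁⟩ := hcon
  obtain ⟨Wf, Wfm, Wf0, hWf, Wfi⟩ := hfW
  obtain ⟨Wg, Wgm, Wg0, hWg, Wgi⟩ := hgW
  obtain ⟨θ, hθdef⟩ : ∃ θ, θ = (f t₁ x₁ - g t₁ x₁ - κ) / 3 := ⟨_, rfl⟩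
  have hθ : 0 < θ := by rw [hθdef]; linarith
  -- spatial and temporal regularity
  have hfx : ∀ t ∈ Icc a b, Differentiable ℝ (f t) := by
    intro t ht x
    have := (hfd t ht x).comp x (f := fun x : EuclideanSpace ℝ (Fin n) => (t, x)) (by fun_prop)
    exact this
  have hgx : ∀ t ∈ Icc a b, Differentiable ℝ (g t) := by
    intro t ht x
    have := (hgd t ht x).comp x (f := fun x : EuclideanSpace ℝ (Fin n) => (t, x)) (by fun_prop)
    exact this
  have hft : ∀ t ∈ Icc a b, ∀ x, DifferentiableAt ℝ (fun s => f s x) t := by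
    intro t ht x
    have := (hfd t ht x).comp t (f := fun s : ℝ => (s, x)) (by fun_prop)
    exact this
  have hgt : ∀ t ∈ Icc a b, ∀ x, DifferentiableAt ℝ (fun s => g s x) t := by
    intro t ht x
    have := (hgd t ht x).comp t (f := fun s : ℝ => (s, x)) (by fun_prop)
    exact this
  have hfl := fun t ht => lip_of_grad (hfx t ht) (hfB t ht)
  have hgl := fun t ht => lip_of_grad (hgx t ht) (hgM t ht)
  -- the growth function
  obtain ⟨C0, hC0⟩ : ∃ C0, ∀ t ∈ Icc a b, ‖f t 0 - g t 0‖ ≤ C0 := by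
    apply isCompact_Icc.exists_bound_of_continuousOn
    intro t ht
    exact ((hft t ht 0).continuousAt.sub (hgt t ht 0).continuousAt).continuousWithinAt
  have hC00 : 0 ≤ C0 := (norm_nonneg _).trans (hC0 a (left_mem_Icc.2 hab.le))
  obtain ⟨W, hW⟩ : ∃ W : ℝ → ℝ, W = fun R => Wf R + Wg R + (C0 + 1) := ⟨_, rfl⟩
  have hWm : Monotone W := by
    intro r s hrs
    simp only [hW]
    linarith [Wfm hrs, Wgm hrs]
  have hW1 : ∀ R, 1 ≤ W R := by
    intro R
    simp only [hW]
    linarith [Wf0 R, Wg0 R]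
  have hWi : IntegrableOn (fun R => W R / R ^ 2) (Ioi 1) := by
    have := (Wfi.add Wgi).add (const_growth (C0 + 1))
    refine IntegrableOn.congr_fun this ?_ measurableSet_Ioi
    intro r _
    simp only [hW, Pi.add_apply]
    ring
  have hWfW : ∀ R, Wf R ≤ W R := fun R => by simp only [hW]; linarith [Wg0 R]
  have hWgW : ∀ R, Wg R ≤ W R := fun R => by simp only [hW]; linarith [Wf0 R]
  have hVi := scaled_growth hWi
  -- parameters
  obtain ⟨δ, hδdef⟩ : ∃ δ, δ = min θ 1 / (2 * (1 + M) ^ 2) := ⟨_, rfl⟩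
  have hδ : 0 < δ := by rw [hδdef]; have := lt_min hθ one_pos; positivity
  have hδe : δ * (2 * (1 + M) ^ 2) = min θ 1 := by rw [hδdef]; field_simp
  have hδ1 : 2 * δ * M ≤ 1 := by
    have : 0 ≤ δ * (2 + 2 * M + 2 * M ^ 2) := by positivity
    linarith [min_le_right θ 1]
  have hδ2 : M * (2 * δ * M) ≤ 1 := by
    have : 0 ≤ δ * (2 + 4 * M) := by positivity
    linarith [min_le_right θ 1]
  have hδ3 : M ^ 2 * δ / 2 < θ := by
    have : 0 < δ * (2 + 4 * M + 3 / 2 * M ^ 2) := by positivity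
    linarith [min_le_left θ 1]
  obtain ⟨η, hηdef⟩ : ∃ η, η = θ / (b - a) := ⟨_, rfl⟩
  have hba : 0 < b - a := by linarith
  have hη : 0 < η := by rw [hηdef]; positivity
  have hηe : η * (b - a) = θ := by rw [hηdef]; field_simp
  have hK := ballC_nonneg n
  set K := ballC n
  obtain ⟨τ, hτ, hτ1, hτ2, hτ3⟩ : ∃ τ > 0, 8 * τ ≤ slopeC d B - M ∧ 4 * τ * ‖x₁‖ ^ 2 ≤ θ / 2 ∧
      K * (4 * τ * (3 / δ + 7)) ≤ η / 4 := by
    have t1 : Tendsto (fun τ : ℝ => 8 * τ) (𝓝[>] 0) (𝓝 (8 * 0)) :=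
      (Continuous.tendsto (by fun_prop) _).mono_left nhdsWithin_le_nhds
    have t2 : Tendsto (fun τ : ℝ => 4 * τ * ‖x₁‖ ^ 2) (𝓝[>] 0) (𝓝 (4 * 0 * ‖x₁‖ ^ 2)) :=
      (Continuous.tendsto (by fun_prop) _).mono_left nhdsWithin_le_nhds
    have t3 : Tendsto (fun τ : ℝ => K * (4 * τ * (3 / δ + 7))) (𝓝[>] 0)
        (𝓝 (K * (4 * 0 * (3 / δ + 7)))) :=
      (Continuous.tendsto (by fun_prop) _).mono_left nhdsWithin_le_nhds
    have e1 := t1.eventually_le_const (u := slopeC d B - M) (by linarith)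
    have e2 := t2.eventually_le_const (u := θ / 2) (by simp; linarith)
    have e3 := t3.eventually_le_const (u := η / 4) (by simp; linarith)
    obtain ⟨τ, h1, h2, h3, h4⟩ := (e1.and (e2.and (e3.and self_mem_nhdsWithin))).exists
    exact ⟨τ, h4, h1, h2, h3⟩
  obtain ⟨R, hRs, hR3, hRx, hRt⟩ : ∃ R, W R / R * Real.log R < τ ∧ 3 ≤ R ∧ ‖x₁‖ ≤ R ∧
      K * (2 * (2 + 3 * B + 3 * M) * ∫ r in Ioi (R / 2), W (3 * r) / r ^ 2) < η / 2 := by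
    have t := ((tail_tendsto hVi).const_mul (2 * (2 + 3 * B + 3 * M))).const_mul K
    have e := t.eventually_lt_const (u := η / 2) (by simp; linarith)
    obtain ⟨R, h1, h2, h3, h4⟩ := ((frequently_small hWi hτ).and_eventually
      ((eventually_ge_atTop 3).and ((eventually_ge_atTop ‖x₁‖).and e))).exists
    exact ⟨R, h1, h2, h3, h4⟩
  have hR0 : 0 < R := by linarith
  have hlog : 1 ≤ Real.log R := by
    rw [Real.le_log_iff_exp_le hR0]
    linarith [Real.exp_one_lt_d9]
  have hWR := hW1 R
  have hWτ : W R / R ≤ τ := by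
    have : 0 ≤ W R / R := by positivity
    have := mul_le_mul_of_nonneg_left hlog this
    linarith
  obtain ⟨ε, hεdef⟩ : ∃ ε, ε = 4 * W R / R ^ 2 := ⟨_, rfl⟩
  have hε : 0 < ε := by rw [hεdef]; positivity
  have hεR : ε * R = 4 * (W R / R) := by rw [hεdef]; field_simp
  have hεR2 : ε * R ^ 2 = 4 * W R := by rw [hεdef]; field_simp
  -- the doubled functional
  set Φ : ℝ × EuclideanSpace ℝ (Fin n) × EuclideanSpace ℝ (Fin n) → ℝ := fun p =>
    f p.1 p.2.1 - g p.1 p.2.2 - ‖p.2.1 - p.2.2‖ ^ 2 / (2 * δ) - ε * ‖p.2.1‖ ^ 2 - η * (p.1 - a) with hΦ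
  have hcomp : IsCompact (Icc a b ×ˢ (Metric.closedBall (0 : EuclideanSpace ℝ (Fin n)) R ×ˢ
      Metric.closedBall (0 : EuclideanSpace ℝ (Fin n)) (R + 1))) :=
    isCompact_Icc.prod ((isCompact_closedBall _ _).prod (isCompact_closedBall _ _))
  have hcont : ContinuousOn Φ (Icc a b ×ˢ (Metric.closedBall (0 : EuclideanSpace ℝ (Fin n)) R ×ˢ
      Metric.closedBall (0 : EuclideanSpace ℝ (Fin n)) (R + 1))) := by
    rintro ⟨t, x, y⟩ ⟨ht, _⟩
    apply ContinuousAt.continuousWithinAt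
    have c1 : ContinuousAt (fun p : ℝ × EuclideanSpace ℝ (Fin n) × EuclideanSpace ℝ (Fin n) =>
        f p.1 p.2.1) (t, x, y) :=
      ContinuousAt.comp' (x := (t, x, y)) (f := fun p : ℝ × EuclideanSpace ℝ (Fin n) × EuclideanSpace ℝ (Fin n) =>
        (p.1, p.2.1)) (hfd t ht x).continuousAt (by fun_prop)
    have c2 : ContinuousAt (fun p : ℝ × EuclideanSpace ℝ (Fin n) × EuclideanSpace ℝ (Fin n) =>
        g p.1 p.2.2) (t, x, y) :=
      ContinuousAt.comp' (x := (t, x, y)) (f := fun p : ℝ × EuclideanSpace ℝ (Fin n) × EuclideanSpace ℝ (Fin n) =>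
        (p.1, p.2.2)) (hgd t ht y).continuousAt (by fun_prop)
    exact (((c1.sub c2).sub (by fun_prop)).sub (by fun_prop)).sub (by fun_prop)
  obtain ⟨⟨t, x, y⟩, ⟨ht, hxR, hyR⟩, hmax'⟩ := hcomp.exists_isMaxOn
    ⟨(a, 0, 0), left_mem_Icc.2 hab.le, by simp; linarith, by simp; linarith⟩ hcont
  simp only [Metric.mem_closedBall, dist_zero_right] at hxR hyR ht
  have hmax : ∀ t' ∈ Icc a b, ∀ x', ‖x'‖ ≤ R → ∀ y', ‖y'‖ ≤ R + 1 →
      f t' x' - g t' y' - ‖x' - y'‖ ^ 2 / (2 * δ) - ε * ‖x'‖ ^ 2 - η * (t' - a)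
      ≤ f t x - g t y - ‖x - y‖ ^ 2 / (2 * δ) - ε * ‖x‖ ^ 2 - η * (t - a) := by
    intro t' ht' x' hx' y' hy'
    exact hmax' (a := (t', x', y')) ⟨ht', by simpa using hx', by simpa using hy'⟩
  -- the points are close
  have hxy : ‖x - y‖ ≤ 2 * δ * M := by
    have h1 := hmax t ht x hxR x (by linarith)
    have h2 := (le_abs_self _).trans (hgl t ht x y)
    simp only [sub_self, norm_zero] at h1
    have h3 : ‖x - y‖ ^ 2 / (2 * δ) ≤ M * ‖x - y‖ := by
      norm_num at h1
      linarith
    rw [div_le_iff₀ (by positivity)] at h3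
    by_contra! hc
    have : 0 < ‖x - y‖ := lt_of_le_of_lt (by positivity) hc
    have := mul_lt_mul_of_pos_right hc this
    linarith
  have hxy1 : ‖x - y‖ ≤ 1 := hxy.trans hδ1
  have hxyM : M * ‖x - y‖ ≤ 1 := (mul_le_mul_of_nonneg_left hxy hM0).trans hδ2
  -- the maximum is large
  have hbig : κ + θ < f t x - g t y - ‖x - y‖ ^ 2 / (2 * δ) - ε * ‖x‖ ^ 2 - η * (t - a) := by
    have h1 := hmax t₁ ht₁ x₁ hRx x₁ (by linarith)
    simp only [sub_self, norm_zero] at h1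
    have h2 : ε * ‖x₁‖ ^ 2 ≤ θ / 2 := by
      have : ε ≤ 4 * τ := by
        have := mul_le_mul_of_nonneg_left (show (1:ℝ) ≤ R by linarith) hε.le
        linarith
      exact (mul_le_mul_of_nonneg_right this (by positivity)).trans hτ2
    have h3 : η * (t₁ - a) ≤ θ := by
      rw [← hηe]
      exact mul_le_mul_of_nonneg_left (by linarith [ht₁.2]) hη.le
    norm_num at h1
    linarith
  have hsq : 0 ≤ ‖x - y‖ ^ 2 / (2 * δ) := by positivity
  have hta : a < t := by
    rcases ht.1.lt_or_eq with h | h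
    · exact h
    exfalso
    subst h
    have h1 := hinit x
    have h2 := (le_abs_self _).trans (hgl a ht x y)
    have h3 : M * ‖x - y‖ - ‖x - y‖ ^ 2 / (2 * δ) ≤ M ^ 2 * δ / 2 := by
      have : M ^ 2 * δ / 2 - (M * ‖x - y‖ - ‖x - y‖ ^ 2 / (2 * δ))
        = (M * δ - ‖x - y‖) ^ 2 / (2 * δ) := by field_simp; ring
      have : 0 ≤ (M * δ - ‖x - y‖) ^ 2 / (2 * δ) := by positivity
      linarith
    have h4 : 0 ≤ ε * ‖x‖ ^ 2 := by positivity
    rw [sub_self, mul_zero] at hbig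
    linarith
  have hηt : 0 ≤ η * (t - a) := mul_nonneg hη.le (by linarith)
  have hx2 : ‖x‖ ≤ R / 2 := by
    have h1 := (abs_le.1 (hWf t ht R hR0.le x hxR)).2
    have h2 := (abs_le.1 (hWg t ht R hR0.le x hxR)).1
    have h3 := (abs_le.1 (hC0 t ht)).2
    have h4 := (le_abs_self _).trans (hgl t ht x y)
    have h5 : ε * ‖x‖ ^ 2 ≤ W R := by
      simp only [hW]
      linarith
    by_contra! hc
    have : (R / 2) ^ 2 < ‖x‖ ^ 2 := by gcongr
    have := mul_lt_mul_of_pos_left this hε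
    linarith
  have hy2 : ‖y‖ ≤ R / 2 + 1 := by
    have : ‖y‖ ≤ ‖x‖ + ‖x - y‖ := by
      have := norm_sub_le x (x - y)
      simpa using this
    linarith
  -- touching inequalities
  set p : EuclideanSpace ℝ (Fin n) := δ⁻¹ • (x - y) with hp
  have hball : ∀ h : EuclideanSpace ℝ (Fin n), ‖h‖ ≤ R / 2 → ‖x + h‖ ≤ R ∧ ‖y + h‖ ≤ R + 1 := by
    intro h hh
    exact ⟨(norm_add_le _ _).trans (by linarith), (norm_add_le _ _).trans (by linarith)⟩
  have hsqx : ∀ h : EuclideanSpace ℝ (Fin n), ε * ‖x + h‖ ^ 2 = ε * ‖x‖ ^ 2 + ε * (2 * ⟪x, h⟫ + ‖h‖ ^ 2) := by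
    intro h
    rw [norm_add_sq_real]; ring
  have hip : ∀ h : EuclideanSpace ℝ (Fin n), ⟪p, h⟫ = ⟪x - y, h⟫ / δ := by
    intro h
    rw [hp, real_inner_smul_left]; field_simp
  have h1 : ∀ h, ‖h‖ ≤ R / 2 →
      f t (x + h) - f t x ≤ g t (y + h) - g t y + ε * (2 * ⟪x, h⟫ + ‖h‖ ^ 2) := by
    intro h hh
    have := hmax t ht (x + h) (hball h hh).1 (y + h) (hball h hh).2
    rw [hsqx, add_sub_add_right_eq_sub] at this
    linarith
  have h2 : ∀ h, ‖h‖ ≤ R / 2 →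
      f t (x + h) - f t x ≤ ⟪p, h⟫ + ‖h‖ ^ 2 / (2 * δ) + ε * (2 * ⟪x, h⟫ + ‖h‖ ^ 2) := by
    intro h hh
    have := hmax t ht (x + h) (hball h hh).1 y (by linarith)
    have e : ‖x + h - y‖ ^ 2 / (2 * δ) = ‖x - y‖ ^ 2 / (2 * δ) + (⟪p, h⟫ + ‖h‖ ^ 2 / (2 * δ)) := by
      rw [add_sub_right_comm, norm_add_sq_real, hip]; field_simp; ring
    rw [hsqx, e] at this
    linarith
  have h3 : ∀ h, ‖h‖ ≤ R / 2 → ⟪p, h⟫ - ‖h‖ ^ 2 / (2 * δ) ≤ g t (y + h) - g t y := by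
    intro h hh
    have := hmax t ht x hxR (y + h) (hball h hh).2
    have e : ‖x - (y + h)‖ ^ 2 / (2 * δ) = ‖x - y‖ ^ 2 / (2 * δ) - (⟪p, h⟫ - ‖h‖ ^ 2 / (2 * δ)) := by
      rw [← sub_sub, norm_sub_sq_real, hip]; field_simp; ring
    rw [e] at this
    linarith
  have hgu : gradient (f t) x = p + (2 * ε) • x := by
    refine grad_of_touch (hfx t ht x) (r := R / 2) (C := 1 / (2 * δ) + ε) (by linarith) ?_
    intro h hh
    refine (h2 h hh).trans (le_of_eq ?_)
    rw [inner_add_left, real_inner_smul_left x h (2 * ε)]; ring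
  have hgv : gradient (g t) y = p := by
    have : gradient (fun z => - g t z) y = -p := by
      refine grad_of_touch (hgx t ht y).neg (r := R / 2) (C := 1 / (2 * δ)) (by linarith) ?_
      intro h hh
      have := h3 h hh
      rw [inner_neg_left]
      have e : 1 / (2 * δ) * ‖h‖ ^ 2 = ‖h‖ ^ 2 / (2 * δ) := by ring
      rw [e]; linarith
    have e : gradient (fun z => - g t z) y = - gradient (g t) y := by
      unfold gradient
      rw [fderiv_fun_neg, map_neg]
    rw [e] at this
    exact neg_injective this
  have hpM : ‖p‖ ≤ M := hgv ▸ hgM t ht y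
  -- time derivative
  have hdt : η ≤ deriv (fun s => f s x) t - deriv (fun s => g s y) t := by
    have hder : HasDerivAt (fun s => f s x - g s y - η * (s - a))
        (deriv (fun s => f s x) t - deriv (fun s => g s y) t - η) t := by
      have e := (((hft t ht x).hasDerivAt.sub (hgt t ht y).hasDerivAt)).sub
        (((hasDerivAt_id t).sub_const a).const_mul η)
      rw [mul_one] at e
      exact e
    have := deriv_nonneg_of_left_max hder hta (fun s hs => by
      have := hmax s ⟨hs.1, hs.2.trans ht.2⟩ x hxR y hyR
      linarith)
    linarith
  obtain ⟨I, hI, hfI⟩ := hfe t ht x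
  obtain ⟨J, hJ, hgJ⟩ := hge t ht y
  have hsp := spatial hd hn hn2 (hfx t ht).continuous (hgx t ht).continuous hB hM0 hδ hε
    (by linarith) (by rw [hεR]; linarith) (hfl t ht) (hgl t ht) hx2 hgu hgv hpM (hfB t ht x) h1 h2 h3
    (V := fun r => W (3 * r)) (fun r => by linarith [hW1 (3 * r)]) hVi
    (fun h hh => by
      have hxh : ‖x + h‖ ≤ 3 * ‖h‖ := (norm_add_le _ _).trans (by linarith)
      have a1 := (hWf t ht (3 * ‖h‖) (by positivity) (x + h) hxh).trans (hWfW _)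
      have a2 := (hWf t ht (3 * ‖h‖) (by positivity) x (by linarith)).trans (hWfW _)
      have a3 := abs_sub_le (f t (x + h)) (f t 0) (f t x)
      rw [abs_sub_comm (f t 0)] at a3
      linarith)
    (fun h hh => by
      have hxh : ‖y + h‖ ≤ 3 * ‖h‖ := (norm_add_le _ _).trans (by linarith)
      have a1 := (hWg t ht (3 * ‖h‖) (by positivity) (y + h) hxh).trans (hWgW _)
      have a2 := (hWg t ht (3 * ‖h‖) (by positivity) y (by linarith)).trans (hWgW _)
      have a3 := abs_sub_le (g t (y + h)) (g t 0) (g t y)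
      rw [abs_sub_comm (g t 0)] at a3
      linarith) hI hJ
  have hfin : K * (3 * (ε * R) / δ + ε * R / 2 + 6 * (ε * R) * Real.log (R / 2)) ≤ η / 4 := by
    refine le_trans (mul_le_mul_of_nonneg_left ?_ hK) hτ3
    have s1 : ε * R ≤ 4 * τ := by rw [hεR]; linarith
    have s2 : ε * R * Real.log (R / 2) ≤ 4 * τ := by
      have : Real.log (R / 2) ≤ Real.log R := Real.log_le_log (by linarith) (by linarith)
      have s3 : ε * R * Real.log (R / 2) ≤ ε * R * Real.log R :=
        mul_le_mul_of_nonneg_left this (by positivity)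
      rw [hεR] at s3 ⊢
      linarith
    have s4 : 3 * (ε * R) / δ ≤ 4 * τ * (3 / δ) := by
      have : 3 * (ε * R) / δ = (ε * R) * (3 / δ) := by ring
      rw [this]
      gcongr
    linarith
  rw [mul_add] at hsp
  linarith

lemma growth_of_classical {d : ℕ} {T : ℝ} {rel : ℝ → ℝ → Prop}
    {f : ℝ → EuclideanSpace ℝ (Fin (d - 1)) → ℝ} (hf : IsClassicalMuskat d T rel f) {a b : ℝ}
    (ha : 0 < a) (hab : a ≤ b) (hb : b < T) :
    ∃ W : ℝ → ℝ, Monotone W ∧ (∀ R, 0 ≤ W R) ∧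
      (∀ t ∈ Icc a b, ∀ R ≥ 0, ∀ h, ‖h‖ ≤ R → |f t h - f t 0| ≤ W R) ∧
      IntegrableOn (fun R => W R / R ^ 2) (Ioi 1) := by
  obtain ⟨ω, Ω, -, -, -, h2, -, h4⟩ := hf.local_bounds (Icc a b ×ˢ {0})
    (isCompact_Icc.prod isCompact_singleton) (by
      rintro ⟨t, x⟩ ⟨ht, -⟩
      exact ⟨⟨ha.trans_le ht.1, ht.2.trans_lt hb⟩, mem_univ _⟩)
  refine exists_growth hab (Ω := Ω) ?_ h4
  intro t ht R hR h hh
  have := h2 (t, 0) ⟨ht, rfl⟩ R hR h hh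
  simpa using this

lemma diff_of_classical {d : ℕ} {T : ℝ} {rel : ℝ → ℝ → Prop}
    {f : ℝ → EuclideanSpace ℝ (Fin (d - 1)) → ℝ} (hf : IsClassicalMuskat d T rel f) {t : ℝ}
    (ht : t ∈ Ioo 0 T) (x : EuclideanSpace ℝ (Fin (d - 1))) :
    DifferentiableAt ℝ (fun p : ℝ × EuclideanSpace ℝ (Fin (d - 1)) => f p.1 p.2) (t, x) := by
  refine (hf.smooth.differentiableOn (by norm_num)).differentiableAt ?_
  exact (isOpen_Ioo.prod isOpen_univ).mem_nhds ⟨ht, mem_univ _⟩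

lemma comp_prop {d : ℕ} (hd : d = 2 ∨ d = 3) {B : ℝ} (hB : 0 < B) :
    MuskatCompProp d B (slopeC d B) := by
  rintro T hT f g hf hg hfB ⟨M, hM, hgM⟩ h0
  have hM0 : 0 ≤ M := (norm_nonneg _).trans (hgM 0 ⟨le_rfl, hT.le⟩ 0)
  have hinner : ∀ t ∈ Ioo 0 T, ∀ x, f t x ≤ g t x := by
    intro t ht x
    refine le_of_forall_pos_le_add fun κ hκ => ?_
    have e1 := Metric.tendstoUniformly_iff.1 hf.limit_zero (κ / 2) (by linarith)
    have e2 := Metric.tendstoUniformly_iff.1 hg.limit_zero (κ / 2) (by linarith)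
    obtain ⟨a, ha1, ha2, ha⟩ := (e1.and (e2.and (Ioo_mem_nhdsGT ht.1))).exists
    obtain ⟨b, hb1, hb2⟩ := exists_between ht.2
    have hsub : ∀ s ∈ Icc a b, s ∈ Ioo 0 T :=
      fun s hs => ⟨ha.1.trans_le hs.1, hs.2.trans_lt hb2⟩
    have hsub' : ∀ s ∈ Icc a b, s ∈ Icc 0 T := fun s hs => Ioo_subset_Icc_self (hsub s hs)
    have hab : a < b := ha.2.trans hb1
    refine core (n := d - 1) (d := d) (by omega) (by omega) (by omega) hB hM0 hM hab hκ.le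
      (fun s hs => diff_of_classical hf (hsub s hs)) (fun s hs => diff_of_classical hg (hsub s hs))
      (growth_of_classical hf ha.1 hab.le hb2) (growth_of_classical hg ha.1 hab.le hb2)
      (fun s hs => hf.eqn s (hsub s hs)) (fun s hs => hg.eqn s (hsub s hs))
      (fun s hs => hfB s (hsub' s hs)) (fun s hs => hgM s (hsub' s hs)) ?_ t
      ⟨ha.2.le, hb1.le⟩ x
    intro z
    have a1 := ha1 z
    have a2 := ha2 z
    rw [Real.dist_eq] at a1 a2
    have a1' := abs_lt.1 a1
    have a2' := abs_lt.1 a2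
    linarith [h0 z, a1'.1, a1'.2, a2'.1, a2'.2]
  intro t ht x
  rcases ht.1.eq_or_lt with h | h
  · subst h
    exact h0 x
  rcases ht.2.eq_or_lt with hlt | hlt
  · subst hlt
    refine le_of_tendsto_of_tendsto (hf.limit_T.tendsto_at x) (hg.limit_T.tendsto_at x) ?_
    filter_upwards [Ioo_mem_nhdsLT h] with s hs
    exact hinner s hs x
  · exact hinner t ⟨h, hlt⟩ x

/-- **Proposition 7.6 of the paper (comparison with small-slope supersolutions).** For
`d = 2` or `3` and any `B > 0` there is `c(B) > 0` such that classical subsolutions with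
slope at most `B` stay below classical supersolutions with slope less than `c(B)`;
moreover, for `B` sufficiently large one may take `c(B) = B/(2(B²+1)^{d/2})`. -/
theorem muskat_comparison_small_slope (d : ℕ) (hd : d = 2 ∨ d = 3) :
    (∀ B > (0 : ℝ), ∃ cB > (0 : ℝ), MuskatCompProp d B cB) ∧
      (∃ B₀ : ℝ, ∀ B : ℝ, B₀ ≤ B →
        MuskatCompProp d B (B / (2 * (B ^ 2 + 1) ^ ((d : ℝ) / 2)))) := by
  refine ⟨fun B hB => ⟨slopeC d B, (slopeC_facts d (by omega) hB).1, comp_prop hd hB⟩, 1, fun B hB => ?_⟩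
  have hB' : 0 < B := by linarith
  have h := comp_prop hd hB'
  unfold slopeC at h
  exact h
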